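/- Let n ≥ 1 be an integer, σ1², σ2², σ_Y² > 0, x1, x2 ∈ ℝ^p, A ⊆ ℝ^p measurable. Set τ² = σ1²/n + σ_Y², β = σ1²/(σ1² + nσ_Y²), σ_T² = σ2² + nσ_Y²β. For y ∈ ℝ^p let T_y ~ N_p( β(y − x1) + (x1 − x2), σ_T² I_p ). Then, writing φ_v for the density of N_p(0, v I_p), ∫_{ℝ^p} φ_{τ²}(y − x1) · [P(T_y ∈ A)]^n dy = P( for all i ∈ {1, …, n}: σ_T U_i + βτ U_0 + (x1 − x2) ∈ A ), where U_0, U_1, …, U_n are i.i.d. N_p(0, I_p). (This identifies the normalization constant of the Bayes predictive density under α-divergence loss with n = 2/(1−α) and uniform prior 1_A(θ1 − θ2).) -/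

import Mathlib

open MeasureTheory Real Set
open scoped BigOperators

noncomputable section

abbrev Ep (p : ℕ) := EuclideanSpace ℝ (Fin p)

/-- Density of `N_p(0, v I_p)` evaluated at `u`. -/
def gdens (p : ℕ) (v : ℝ) (u : Ep p) : ℝ :=
  (2 * Real.pi * v) ^ (-(p : ℝ) / 2) * Real.exp (-‖u‖ ^ 2 / (2 * v))

/-- The affine change of variables turning `N_p(c, v I_p)` into the standard normal law. -/
lemma integral_gdens_sub {p : ℕ} {v : ℝ} (hv : 0 < v) (c : Ep p) (f : Ep p → ℝ) :
    ∫ t, f t * gdens p v (t - c) = ∫ u, f (√v • u + c) * gdens p 1 u := by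
  have hd (u : Ep p) : gdens p 1 u = √v ^ p * gdens p v (√v • u) := by
    have hpow : v ^ (-(p : ℝ) / 2) = (√v ^ p)⁻¹ := by
      rw [Real.sqrt_eq_rpow, ← Real.rpow_natCast, ← Real.rpow_mul hv.le, ← Real.rpow_neg hv.le]
      congr 1
      ring
    have hs : (√v ^ p) ≠ 0 := by positivity
    have hn : -(√v * ‖u‖) ^ 2 / (2 * v) = -‖u‖ ^ 2 / (2 * 1) := by
      rw [mul_pow, Real.sq_sqrt hv.le]
      field_simp
    simp only [gdens, norm_smul, Real.norm_of_nonneg (Real.sqrt_nonneg v), hn]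
    rw [Real.mul_rpow (by positivity) hv.le, hpow]
    field_simp
  rw [← integral_add_right_eq_self _ c]
  have h := Measure.integral_comp_smul_of_nonneg (volume : Measure (Ep p))
    (fun x => f (x + c) * gdens p v x) (√v) (hR := Real.sqrt_nonneg v)
  simp only [finrank_euclideanSpace, Fintype.card_fin, smul_eq_mul] at h
  simp only [add_sub_cancel_right, hd]
  rw [show (fun u : Ep p => f (√v • u + c) * (√v ^ p * gdens p v (√v • u))) =
    fun u => √v ^ p * (f (√v • u + c) * gdens p v (√v • u)) by ext; ring]
  rw [integral_const_mul, h, mul_inv_cancel_left₀ (by positivity)]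

lemma integrable_gdens (p : ℕ) {v : ℝ} (hv : 0 < v) : Integrable (gdens p v) := by
  have h := (GaussianFourier.integrable_cexp_neg_mul_sq_norm_add (V := Ep p)
    (b := ((2 * v)⁻¹ : ℝ)) (by simpa using hv) 0 0).norm
  refine (h.congr (.of_forall fun u => ?_)).const_mul _
  simp only [Complex.norm_exp]
  norm_num [← Complex.ofReal_pow]
  norm_cast
  ring

/-- If `g` is a density shared by independent `u 0, …, u n`, then conditionally on `u 0` the events
`φ (u 0, u i) ∈ A` are independent with equal probabilities. -/
lemma integral_pi_succ_eq_integral_pow {E F : Type*} [MeasureSpace E]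
    [SigmaFinite (volume : Measure E)] [MeasurableSpace F] {n : ℕ} {A : Set F}
    (hA : MeasurableSet A) {φ : E × E → F} (hφ : Measurable φ) {g : E → ℝ} (hg : Integrable g) :
    ∫ u : Fin (n + 1) → E, {u : Fin (n + 1) → E | ∀ i : Fin n, φ (u 0, u i.succ) ∈ A}.indicator
        (fun _ => (1 : ℝ)) u * ∏ i, g (u i) =
      ∫ x, (∫ w, A.indicator (fun _ => (1 : ℝ)) (φ (x, w)) * g w) ^ n * g x := by
  have hprod : Integrable fun z : E × (Fin n → E) => g z.1 * ∏ i, g (z.2 i) :=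
    hg.mul_prod (Integrable.fintype_prod fun _ => hg)
  set S : Set (E × (Fin n → E)) := {z | ∀ i, φ (z.1, z.2 i) ∈ A} with hS
  have hSm : MeasurableSet S := by
    rw [hS, ← iInter_ofPred]
    exact .iInter fun i => (show Measurable fun z : E × (Fin n → E) => φ (z.1, z.2 i) by
      fun_prop) hA
  have hint := hprod.indicator hSm
  rw [← ((volume_preserving_piFinSuccAbove (fun _ : Fin (n + 1) => E) 0).symm _).integral_comp']
  trans ∫ z, S.indicator (fun z : E × (Fin n → E) => g z.1 * ∏ i, g (z.2 i)) z
  · congr 1 with z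
    by_cases hz : ∀ i, φ (z.1, z.2 i) ∈ A <;>
      simp [hS, indicator, hz, Fin.prod_univ_succ, MeasurableEquiv.piFinSuccAbove]
  · rw [Measure.volume_eq_prod, integral_prod _ hint]
    congr 1 with x
    have hpow := integral_fintype_prod_volume_eq_pow (ι := Fin n)
      (fun w => A.indicator (fun _ => (1 : ℝ)) (φ (x, w)) * g w)
    rw [Fintype.card_fin] at hpow
    rw [← hpow, mul_comm, ← integral_const_mul]
    congr 1 with w
    by_cases hw : ∀ i, φ (x, w i) ∈ A
    · simp [hS, hw]
    · obtain ⟨i, hi⟩ := not_forall.1 hw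
      rw [Finset.prod_eq_zero (Finset.mem_univ i) (by simp [hi])]
      simp [hS, hw]

/-- Normalization-constant identity for the Bayes predictive density under
α-divergence loss with `n = 2/(1-α)` and uniform prior `1_A(θ1-θ2)`:
`∫ φ_{τ²}(y - x1) [P(T_y ∈ A)]^n dy
 = P(∀ i ≤ n, σ_T U_i + βτ U_0 + (x1 - x2) ∈ A)` with `U_0, …, U_n` i.i.d.
standard `p`-variate normal. -/
theorem stmt11 (p n : ℕ) (hn : 1 ≤ n)
    (σ12 σ22 σY2 : ℝ) (hσ1 : 0 < σ12) (hσ2 : 0 < σ22) (hσY : 0 < σY2)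
    (x1 x2 : Ep p) (A : Set (Ep p)) (hA : MeasurableSet A)
    (τ2 β σT2 : ℝ)
    (hτ2 : τ2 = σ12 / (n : ℝ) + σY2)
    (hβ : β = σ12 / (σ12 + (n : ℝ) * σY2))
    (hσT2 : σT2 = σ22 + (n : ℝ) * σY2 * β) :
    (∫ y : Ep p, gdens p τ2 (y - x1) *
        (∫ t in A, gdens p σT2 (t - (β • (y - x1) + (x1 - x2)))) ^ n) =
      ∫ u : Fin (n + 1) → Ep p,
        Set.indicator
          {u : Fin (n + 1) → Ep p | ∀ i : Fin n,
            Real.sqrt σT2 • u i.succ + (β * Real.sqrt τ2) • u 0 + (x1 - x2) ∈ A}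
          (fun _ => (1 : ℝ)) u * ∏ i, gdens p 1 (u i) := by
  have hn0 : (0 : ℝ) < n := by exact_mod_cast hn
  have hβ0 : 0 < β := by rw [hβ]; positivity
  have hτ0 : 0 < τ2 := by rw [hτ2]; positivity
  have hσ0 : 0 < σT2 := by rw [hσT2]; positivity
  have hinner (c : Ep p) : ∫ t in A, gdens p σT2 (t - c) =
      ∫ w, A.indicator (fun _ => (1 : ℝ)) (√σT2 • w + c) * gdens p 1 w := by
    rw [← integral_gdens_sub hσ0, ← integral_indicator hA]
    congr 1 with t
    by_cases ht : t ∈ A <;> simp [ht]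
  simp_rw [hinner, mul_comm (gdens p τ2 _)]
  rw [integral_gdens_sub hτ0 x1 (fun y => (∫ w, A.indicator (fun _ => (1 : ℝ))
    (√σT2 • w + (β • (y - x1) + (x1 - x2))) * gdens p 1 w) ^ n)]
  rw [integral_pi_succ_eq_integral_pow hA (by fun_prop : Measurable fun z : Ep p × Ep p =>
    √σT2 • z.2 + (β * √τ2) • z.1 + (x1 - x2)) (integrable_gdens p one_pos)]
  simp only [add_sub_cancel_right, smul_smul, add_assoc]

end
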